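/- Let n ≥ 1, c, H > 0 and b, m² ≥ 0 with b² ≥ 4m². Let β ≥ 0 and p > 1 satisfy n/2 − √(b²−4m²)/(2H) ≤ 1/p, let ϱ = ϱ_crit(n,H,b,m²,β,p) := (1/2)(b − √(b²−4m²))((β+1)p − 1) + nH(β+1)(p−1), and let ς > κ_crit(b,m²,β,p), where κ_crit := −1 if b² > 4m² and κ_crit := −1 − (β+1)p if b² = 4m². Take Γ(t) = μ e^{ϱ_crit t}(1+t)^ς with μ > 0. Assume v₀, v₁ ∈ L¹_loc(ℝⁿ) are nonnegative, nontrivial, and supported in B_R for some R > 0, and let v be a weak solution of the anti-de Sitter problem with lifespan T(ε). Then there exists ε₀ > 0 such that for every ε ∈ (0, ε₀] the solution v blows up in finite time, and T(ε) ≤ C ε^{−((β+1)p−1)/(ς+1)} if b² > 4m², while T(ε) ≤ C ε^{−( (ς+2)/((β+1)p−1) + 1 )^{−1}} if b² = 4m², where C > 0 is independent of ε. -/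

import Mathlib

open MeasureTheory Real Set

noncomputable section

/-- `ℝⁿ` as a Euclidean space. -/
abbrev Eucl (n : ℕ) := EuclideanSpace ℝ (Fin n)

/-- The Laplace operator on functions `ℝⁿ → ℝ`, written as the sum of the second-order
partial derivatives in the coordinate directions. -/
def lapl {n : ℕ} (f : Eucl n → ℝ) (x : Eucl n) : ℝ :=
  ∑ i : Fin n,
    fderiv ℝ (fun y => fderiv ℝ f y (EuclideanSpace.single i 1)) x (EuclideanSpace.single i 1)

/-- A test function `φ ∈ C_0^∞([0,T) × ℝⁿ)`: smooth, compactly supported, with support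
contained in `[0,T') × ℝⁿ` for some `T' < T`. -/
structure IsTestFn {n : ℕ} (T : ℝ) (φ : ℝ → Eucl n → ℝ) : Prop where
  smooth : ContDiff ℝ (⊤ : ℕ∞) (fun q : ℝ × Eucl n => φ q.1 q.2)
  cpt : HasCompactSupport (fun q : ℝ × Eucl n => φ q.1 q.2)
  vanish : ∃ T' : ℝ, T' < T ∧ ∀ s ≥ T', ∀ x, φ s x = 0

/-- Weak solution (with `C¹` regularity in time) on `[0,T)` of the semilinear wave equation
in anti-de Sitter spacetime
`∂_t²v − c²e^{2Ht}Δv + b ∂_t v + m²v = Γ(t) (∫ |v(t,y)|^p dy)^β |v|^p`,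
with data `v(0,·) = ε v₀`, `∂_t v(0,·) = ε v₁` supported in `B_R`.
Here `vt` denotes the time derivative `∂_t v`. -/
structure IsWeakSolADS (n : ℕ) (c H b m2 p β : ℝ) (Γ : ℝ → ℝ) (ε : ℝ)
    (v0 v1 : Eucl n → ℝ) (R T : ℝ) (v vt : ℝ → Eucl n → ℝ) : Prop where
  /-- `v(t,·) ∈ L¹_loc`: by the support condition it is in fact integrable. -/
  integ_v : ∀ t ∈ Ico (0:ℝ) T, Integrable (v t)
  integ_vt : ∀ t ∈ Ico (0:ℝ) T, Integrable (vt t)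
  integ_pow : ∀ t ∈ Ico (0:ℝ) T, Integrable (fun x => |v t x| ^ p)
  /-- `v ∈ C¹([0,T), L¹_loc(ℝⁿ))`, tested against continuous compactly supported functions:
  `vt` is the time derivative of `v` and is continuous in time. -/
  c1 : ∀ g : Eucl n → ℝ, Continuous g → HasCompactSupport g →
      (∀ t ∈ Ico (0:ℝ) T,
        HasDerivWithinAt (fun s => ∫ x, v s x * g x) (∫ x, vt t x * g x) (Ico (0:ℝ) T) t) ∧
      ContinuousOn (fun t => ∫ x, vt t x * g x) (Ico (0:ℝ) T)
  /-- `f(t,v) ∈ L¹_loc((0,T) × ℝⁿ)`. -/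
  nonlin_L1loc : ∀ t ∈ Ico (0:ℝ) T,
      IntervalIntegrable (fun s => Γ s * (∫ y, |v s y| ^ p) ^ β * ∫ x, |v s x| ^ p) volume 0 t
  /-- support condition: `supp v(t,·) ⊆ B_{R + (c/H)(e^{Ht} − 1)}`. -/
  supp : ∀ t ∈ Ioo (0:ℝ) T, ∀ x, v t x ≠ 0 → ‖x‖ ≤ R + (c / H) * (exp (H * t) - 1)
  /-- the weak formulation of the equation. -/
  identity : ∀ t ∈ Ioo (0:ℝ) T, ∀ φ : ℝ → Eucl n → ℝ, IsTestFn T φ →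
      (∫ x, vt t x * φ t x) - (∫ x, v t x * deriv (fun s => φ s x) t)
        + b * (∫ x, v t x * φ t x)
        + (∫ s in (0:ℝ)..t, ∫ x, v s x *
            (deriv (deriv (fun r => φ r x)) s
              - c ^ 2 * exp (2 * H * s) * lapl (fun y => φ s y) x
              - b * deriv (fun r => φ r x) s + m2 * φ s x))
      = ε * (∫ x, v1 x * φ 0 x)
        + ε * (∫ x, v0 x * (b * φ 0 x - deriv (fun s => φ s x) 0))
        + (∫ s in (0:ℝ)..t, Γ s * (∫ y, |v s y| ^ p) ^ β * (∫ x, |v s x| ^ p * φ s x))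


lemma pos_of_bootstrap (D : ℝ → ℝ) (D1 : ℝ → ℝ) (S : ℝ)
    (hc : ContinuousOn D (Ico 0 S)) (hd : ∀ t ∈ Ioo 0 S, HasDerivAt D (D1 t) t)
    (h0 : 0 < D 0)
    (hb : ∀ t ∈ Ioo 0 S, (∀ s ∈ Icc 0 t, 0 ≤ D s) → 0 ≤ D1 t) :
    ∀ t ∈ Ico 0 S, 0 < D t := by
  intro t ht
  by_contra hneg
  push Not at hneg
  have hsub : Icc 0 t ⊆ Ico 0 S := fun s hs => ⟨hs.1, lt_of_le_of_lt hs.2 ht.2⟩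
  have hcl : IsCompact (Icc 0 t ∩ D ⁻¹' Iic 0) :=
    isCompact_Icc.of_isClosed_subset
      ((hc.mono hsub).preimage_isClosed_of_isClosed isClosed_Icc isClosed_Iic) inter_subset_left
  obtain ⟨r, ⟨⟨hr0, hrt⟩, hrD⟩, hmin⟩ := hcl.exists_isLeast ⟨t, ⟨ht.1, le_rfl⟩, hneg⟩
  have hrD : D r ≤ 0 := hrD
  have hpos : ∀ s, 0 ≤ s → s < r → 0 < D s := by
    intro s hs0 hsr
    by_contra h
    push Not at h
    have := hmin ⟨⟨hs0, hsr.le.trans hrt⟩, h⟩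
    linarith
  have hmono : MonotoneOn D (Icc 0 r) := by
    apply monotoneOn_of_deriv_nonneg (convex_Icc 0 r)
    · exact hc.mono fun s hs => ⟨hs.1, by linarith [hs.2, ht.2]⟩
    · rw [interior_Icc]
      intro s hs
      exact (hd s ⟨hs.1, by linarith [hs.2, ht.2]⟩).differentiableAt.differentiableWithinAt
    · rw [interior_Icc]
      intro s hs
      have hs' : s ∈ Ioo 0 S := ⟨hs.1, by linarith [hs.2, ht.2]⟩
      rw [(hd s hs').deriv]
      exact hb s hs' fun u hu => (hpos u hu.1 (lt_of_le_of_lt hu.2 hs.2)).le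
  have := hmono ⟨le_rfl, hr0⟩ ⟨hr0, le_rfl⟩ hr0
  linarith

lemma ode_comparison (δ K q ς a T0 : ℝ) (hK : 0 < K) (hq : 1 < q) (Y Y1 Y2 U U1 F : ℝ → ℝ)
    (hY : ∀ t ∈ Ico 0 T0, HasDerivAt Y (Y1 t) t)
    (hY1 : ∀ t ∈ Ico 0 T0, HasDerivAt Y1 (Y2 t) t)
    (hsub : ∀ t ∈ Ioo 0 T0, Y2 t + δ * Y1 t ≤ K * (1 + t) ^ ς * (Y t) ^ q)
    (hYn : ∀ t ∈ Ico 0 T0, 0 ≤ Y t)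
    (hUc : ContinuousOn U (Ico 0 T0)) (hU : ∀ t ∈ Ioo 0 T0, HasDerivAt U (U1 t) t)
    (hU1 : ∀ t ∈ Ioo 0 T0, exp (δ * t) * U1 t = a + ∫ s in (0:ℝ)..t, F s)
    (hFi : ∀ t ∈ Ioo 0 T0, IntervalIntegrable F volume 0 t)
    (hF : ∀ s ∈ Ioo 0 T0, K * exp (δ * s) * (1 + s) ^ ς * |U s| ^ q ≤ F s)
    (h0 : Y 0 < U 0) (h1 : Y1 0 ≤ a) : ∀ t ∈ Ico 0 T0, Y t < U t := by
  have := pos_of_bootstrap (fun t => U t - Y t) (fun t => U1 t - Y1 t) T0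
    (hUc.sub fun t ht => (hY t ht).continuousAt.continuousWithinAt)
    (fun t ht => (hU t ht).sub (hY t ⟨ht.1.le, ht.2⟩)) (by simpa using h0) ?_
  · intro t ht
    have := this t ht
    linarith
  intro t ht hle
  have hsub' : Icc 0 t ⊆ Ico 0 T0 := fun s hs => ⟨hs.1, lt_of_le_of_lt hs.2 ht.2⟩
  have key := intervalIntegral.sub_le_integral_of_hasDeriv_right_of_le (a := 0) (b := t)
    (g := fun s => exp (δ * s) * Y1 s)
    (g' := fun s => exp (δ * s) * δ * Y1 s + exp (δ * s) * Y2 s) (φ := F) ht.1.le ?_ ?_ ?_ ?_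
  · simp only [mul_zero, exp_zero, one_mul] at key
    have h2 := hU1 t ht
    have h3 : exp (δ * t) * Y1 t ≤ exp (δ * t) * U1 t := by linarith
    have := le_of_mul_le_mul_left h3 (exp_pos _)
    linarith
  · intro s hs
    refine ContinuousWithinAt.mul (by fun_prop) (hY1 s (hsub' hs)).continuousAt.continuousWithinAt
  · intro s hs
    have hE : HasDerivAt (fun s => exp (δ * s)) (exp (δ * s) * δ) s := by
      simpa using ((hasDerivAt_id s).const_mul δ).exp
    exact (hE.mul (hY1 s (hsub' ⟨hs.1.le, hs.2.le⟩))).hasDerivWithinAt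
  · exact (intervalIntegrable_iff_integrableOn_Icc_of_le ht.1.le).1 (hFi t ht)
  · intro s hs
    have hs' : s ∈ Ioo 0 T0 := ⟨hs.1, by linarith [hs.2, ht.2]⟩
    refine le_trans ?_ (hF s hs')
    have e1 := hsub s hs'
    have e2 : Y s ^ q ≤ |U s| ^ q := by
      apply rpow_le_rpow (hYn s ⟨hs.1.le, hs'.2⟩) _ (by linarith)
      have := hle s ⟨hs.1.le, hs.2.le⟩
      exact le_trans (by linarith) (le_abs_self _)
    have e3 : K * (1 + s) ^ ς * (Y s) ^ q ≤ K * (1 + s) ^ ς * |U s| ^ q := by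
      apply mul_le_mul_of_nonneg_left e2
      have : 0 < 1 + s := by linarith [hs.1]
      positivity
    calc _ = exp (δ * s) * (Y2 s + δ * Y1 s) := by ring
      _ ≤ exp (δ * s) * (K * (1 + s) ^ ς * |U s| ^ q) :=
        mul_le_mul_of_nonneg_left (e1.trans e3) (exp_pos _).le
      _ = _ := by ring

/-- derivative facts of the model profile -/
lemma profile (θ a h Y0 t : ℝ) (ht : 0 ≤ t) (hθ : 0 < θ) (ha : 0 < a) (hh : 0 < h)
    (hY0 : 0 < Y0) (hP : h * (1 + t) ^ θ < 1) :
    HasDerivAt (fun t => Y0 * (1 - h * (1 + t) ^ θ) ^ (-a))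
      (Y0 * (a * θ * h) * ((1 + t) ^ (θ - 1) * (1 - h * (1 + t) ^ θ) ^ (-a - 1))) t ∧
    HasDerivAt (fun t => Y0 * (a * θ * h) * ((1 + t) ^ (θ - 1) * (1 - h * (1 + t) ^ θ) ^ (-a - 1)))
      (Y0 * (a * θ * h) * (((θ - 1) * (1 + t) ^ (θ - 1 - 1)) * (1 - h * (1 + t) ^ θ) ^ (-a - 1)
        + (1 + t) ^ (θ - 1) * (-(h * (θ * (1 + t) ^ (θ - 1))) * (-a - 1)
          * (1 - h * (1 + t) ^ θ) ^ (-a - 1 - 1)))) t ∧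
    (Y0 * (a * θ * h) * ((1 + t) ^ (θ - 1) * (1 - h * (1 + t) ^ θ) ^ (-a - 1))
      ≤ Y0 * (a * θ * h) * ((1 + t) ^ (θ - 1) * (1 - h * (1 + t) ^ θ) ^ (-a - 2))) ∧
    ((1 + t) * (Y0 * (a * θ * h) *
        (((θ - 1) * (1 + t) ^ (θ - 1 - 1)) * (1 - h * (1 + t) ^ θ) ^ (-a - 1)
        + (1 + t) ^ (θ - 1) * (-(h * (θ * (1 + t) ^ (θ - 1))) * (-a - 1)
          * (1 - h * (1 + t) ^ θ) ^ (-a - 1 - 1))))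
      ≤ (a + 2) * θ *
        (Y0 * (a * θ * h) * ((1 + t) ^ (θ - 1) * (1 - h * (1 + t) ^ θ) ^ (-a - 2)))) := by
  have h1t : 0 < 1 + t := by linarith
  have hPp : 0 < 1 - h * (1 + t) ^ θ := by linarith
  have hr : ∀ e : ℝ, HasDerivAt (fun t : ℝ => (1 + t) ^ e) (e * (1 + t) ^ (e - 1)) t := by
    intro e
    have := ((hasDerivAt_id t).const_add 1).rpow_const (p := e) (Or.inl h1t.ne')
    simpa using this
  have hPd : HasDerivAt (fun t : ℝ => 1 - h * (1 + t) ^ θ) (-(h * (θ * (1 + t) ^ (θ - 1)))) t :=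
    ((hr θ).const_mul h).const_sub 1
  have hPr : ∀ e : ℝ, HasDerivAt (fun t : ℝ => (1 - h * (1 + t) ^ θ) ^ e)
      (-(h * (θ * (1 + t) ^ (θ - 1))) * e * (1 - h * (1 + t) ^ θ) ^ (e - 1)) t := fun e =>
    hPd.rpow_const (Or.inl hPp.ne')
  have hle : (1 - h * (1 + t) ^ θ) ^ (-a - 1) ≤ (1 - h * (1 + t) ^ θ) ^ (-a - 2) := by
    apply rpow_le_rpow_of_exponent_ge hPp
    · have : 0 < h * (1 + t) ^ θ := by positivity
      linarith
    · linarith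
  refine ⟨?_, ((hr (θ - 1)).mul (hPr (-a - 1))).const_mul _, ?_, ?_⟩
  · refine ((hPr (-a)).const_mul Y0).congr_deriv ?_
    ring
  · gcongr
  · have e1 : (1 + t) * (1 + t) ^ (θ - 1 - 1) = (1 + t) ^ (θ - 1) := by
      rw [rpow_sub_one h1t.ne' (θ - 1)]; field_simp
    have e2 : (1 + t) * (1 + t) ^ (θ - 1) = (1 + t) ^ θ := by
      rw [rpow_sub_one h1t.ne' θ]; field_simp
    have e3 : -a - 1 - 1 = -a - 2 := by ring
    rw [e3]
    generalize hx : (1 - h * (1 + t) ^ θ) ^ (-a - 1) = x at *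
    generalize hy : (1 - h * (1 + t) ^ θ) ^ (-a - 2) = y at *
    have hx0 : 0 < x := by rw [← hx]; positivity
    have hy0 : 0 < y := by rw [← hy]; positivity
    have hg0 : 0 < (1 + t) ^ (θ - 1) := by positivity
    calc _ = Y0 * (a * θ * h) * ((θ - 1) * ((1 + t) * (1 + t) ^ (θ - 1 - 1)) * x
        + (1 + t) ^ (θ - 1) * ((a + 1) * θ * (h * ((1 + t) * (1 + t) ^ (θ - 1))) * y)) := by ring
      _ = Y0 * (a * θ * h) * (1 + t) ^ (θ - 1) * ((θ - 1) * x
        + (a + 1) * θ * (h * (1 + t) ^ θ) * y) := by rw [e1, e2]; ring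
      _ ≤ Y0 * (a * θ * h) * (1 + t) ^ (θ - 1) * (θ * y + (a + 1) * θ * 1 * y) := by
        gcongr ?_ * (?_ + ?_ * ?_ * ?_ * ?_)
        · nlinarith
      _ = _ := by ring

set_option maxHeartbeats 1000000 in
lemma ode_lifespan (δ K q ς θ A I0 : ℝ) (hδ : 0 ≤ δ) (hK : 0 < K) (hq : 1 < q) (hθ : 0 < θ)
    (hA : 0 < A) (hI0 : 0 < I0) (hcase : θ = ς + 1 ∨ (δ = 0 ∧ θ = ς + 1 + q)) :
    ∃ C > 0, ∀ ε : ℝ, 0 < ε → ε ≤ 1 → ∀ (T : ℝ) (U U1 F : ℝ → ℝ),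
      ContinuousOn U (Ico 0 T) → (∀ t ∈ Ioo 0 T, HasDerivAt U (U1 t) t) →
      (∀ t ∈ Ioo 0 T, exp (δ * t) * U1 t = ε * A + ∫ s in (0:ℝ)..t, F s) →
      (∀ t ∈ Ioo 0 T, IntervalIntegrable F volume 0 t) →
      (∀ s ∈ Ioo 0 T, K * exp (δ * s) * (1 + s) ^ ς * |U s| ^ q ≤ F s) →
      U 0 = ε * I0 → T ≤ C * ε ^ (-((q - 1) / θ)) := by
  obtain ⟨a, ha⟩ : ∃ a, a = 2 / (q - 1) := ⟨_, rfl⟩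
  have hq1 : 0 < q - 1 := by linarith
  have ha0 : 0 < a := by rw [ha]; positivity
  have haq : a * q = a + 2 := by rw [ha]; field_simp; ring
  obtain ⟨L, hL⟩ : ∃ L, L = (a + 2) * θ + δ + 2 := ⟨_, rfl⟩
  have hL0 : 0 < L := by rw [hL]; positivity
  obtain ⟨κ, hκ0, hκ1, hκ2⟩ : ∃ κ > 0, κ ≤ 1 / 2 ∧ κ * (a * θ * L) ≤ K := by
    refine ⟨min (1/2) (K / (a * θ * L)), by positivity, min_le_left _ _, ?_⟩
    rw [← le_div_iff₀ (by positivity)]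
    exact min_le_right _ _
  obtain ⟨η, hη0, hη1, hη2, hη3⟩ : ∃ η > 0, η ≤ 1 ∧ η * 2 ^ a < I0 ∧
      η * ((1 + a * θ) * 2 ^ (a + 1)) ≤ A := by
    refine ⟨min 1 (min (I0 / 2 / 2 ^ a) (A / ((1 + a * θ) * 2 ^ (a + 1)))), by positivity,
      min_le_left _ _, ?_, ?_⟩
    · have h2 : I0 / 2 / 2 ^ a < I0 / 2 ^ a := by
        apply div_lt_div_of_pos_right _ (by positivity)
        linarith
      rw [← lt_div_iff₀ (by positivity)]
      exact lt_of_le_of_lt ((min_le_right _ _).trans (min_le_left _ _)) h2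
    · rw [← le_div_iff₀ (by positivity)]
      exact (min_le_right _ _).trans (min_le_right _ _)
  refine ⟨(κ * η ^ (q - 1)) ^ (-θ⁻¹), by positivity, ?_⟩
  intro ε hε hε1 T U U1 F hUc hU hU1 hFi hF hU0
  obtain ⟨Y0, hY0⟩ : ∃ Y0, Y0 = η * ε := ⟨_, rfl⟩
  have hY0p : 0 < Y0 := by rw [hY0]; positivity
  obtain ⟨h, hh⟩ : ∃ h, h = κ * Y0 ^ (q - 1) := ⟨_, rfl⟩
  have hhp : 0 < h := by rw [hh]; positivity
  have hh2 : h ≤ 1 / 2 := by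
    have : Y0 ^ (q - 1) ≤ 1 := by
      apply rpow_le_one hY0p.le _ hq1.le
      rw [hY0]; nlinarith
    rw [hh]
    nlinarith
  have hC : (κ * η ^ (q - 1)) ^ (-θ⁻¹) * ε ^ (-((q - 1) / θ)) = h ^ (-θ⁻¹) := by
    rw [hh, hY0, mul_rpow hη0.le hε.le, ← mul_assoc,
      mul_rpow (x := κ * η ^ (q - 1)) (by positivity) (by positivity), ← rpow_mul hε.le]
    congr 2
    field_simp
  rw [hC]
  obtain ⟨T0, hT0⟩ : ∃ T0, T0 = h ^ (-θ⁻¹) - 1 := ⟨_, rfl⟩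
  have hT01 : 1 + T0 = h ^ (-θ⁻¹) := by rw [hT0]; ring
  have hT0P : h * (1 + T0) ^ θ = 1 := by
    rw [hT01, ← rpow_mul hhp.le]
    have : -θ⁻¹ * θ = -1 := by field_simp
    rw [this, rpow_neg_one]
    field_simp
  suffices T ≤ T0 by linarith
  by_contra hlt
  push Not at hlt
  have hT0pos : 0 < T0 := by
    have : 1 < h ^ (-θ⁻¹) := one_lt_rpow_of_pos_of_lt_one_of_neg hhp (by linarith) (by
      have : 0 < θ⁻¹ := by positivity
      linarith)
    linarith
  have hPlt : ∀ t ∈ Ico 0 T0, h * (1 + t) ^ θ < 1 := by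
    intro t ht
    have := ht.1
    have := ht.2
    refine lt_of_lt_of_eq ?_ hT0P
    gcongr
  have hmain : ∀ t ∈ Ico 0 T0, Y0 * (1 - h * (1 + t) ^ θ) ^ (-a) < U t := by
    have hIoo : Ioo 0 T0 ⊆ Ioo 0 T := Ioo_subset_Ioo_right hlt.le
    have hIco : Ico 0 T0 ⊆ Ico 0 T := Ico_subset_Ico_right hlt.le
    have hhalf : ∀ e : ℝ, 0 ≤ e → (1 - h) ^ (-e) ≤ 2 ^ e := by
      intro e he
      rw [rpow_neg (by linarith), ← inv_rpow (by linarith)]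
      apply rpow_le_rpow (by rw [inv_nonneg]; linarith) _ he
      rw [inv_le_comm₀ (by linarith) (by norm_num)]
      linarith
    have ha1 := hhalf a ha0.le
    have ha2 := hhalf (a + 1) (by linarith)
    have ha3 : (2:ℝ) ^ a ≤ 2 ^ (a + 1) := rpow_le_rpow_of_exponent_le (by norm_num) (by linarith)
    have hb1 : Y0 * (1 - h) ^ (-a) < ε * I0 := by
      calc Y0 * (1 - h) ^ (-a) ≤ Y0 * 2 ^ a := by gcongr
        _ = ε * (η * 2 ^ a) := by rw [hY0]; ring
        _ < ε * I0 := by gcongr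
    have hb2 : Y0 * (1 - h) ^ (-a) + Y0 * (a * θ * h) * (1 - h) ^ (-a - 1) ≤ ε * A := by
      have e : -a - 1 = -(a + 1) := by ring
      rw [e]
      calc _ ≤ Y0 * 2 ^ (a + 1) + Y0 * (a * θ * 1) * 2 ^ (a + 1) := by
            have : 0 ≤ (1 - h) ^ (-(a + 1)) := rpow_nonneg (by linarith) _
            gcongr
            · exact ha1.trans ha3
            · linarith
        _ = ε * (η * ((1 + a * θ) * 2 ^ (a + 1))) := by rw [hY0]; ring
        _ ≤ ε * A := by gcongr
    have hsubkey : ∀ t ∈ Ico 0 T0,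
        L * (Y0 * (a * θ * h) * ((1 + t) ^ (θ - 1) * (1 - h * (1 + t) ^ θ) ^ (-a - 2)))
        ≤ K * (1 + t) ^ (θ - 1) * (Y0 * (1 - h * (1 + t) ^ θ) ^ (-a)) ^ q := by
      intro t ht
      have h1t : 0 < 1 + t := by linarith [ht.1]
      have hPp : 0 < 1 - h * (1 + t) ^ θ := by linarith [hPlt t ht]
      rw [mul_rpow hY0p.le (by positivity), ← rpow_mul hPp.le]
      have e : -a * q = -a - 2 := by linarith
      have e' : Y0 ^ q = Y0 * Y0 ^ (q - 1) := by
        rw [rpow_sub_one hY0p.ne']; field_simp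
      rw [e, e', hh]
      calc _ = (κ * (a * θ * L)) * (Y0 * Y0 ^ (q - 1) * ((1 + t) ^ (θ - 1) *
            (1 - κ * Y0 ^ (q - 1) * (1 + t) ^ θ) ^ (-a - 2))) := by ring
        _ ≤ K * (Y0 * Y0 ^ (q - 1) * ((1 + t) ^ (θ - 1) *
            (1 - κ * Y0 ^ (q - 1) * (1 + t) ^ θ) ^ (-a - 2))) := by
            apply mul_le_mul_of_nonneg_right hκ2
            rw [← hh]
            positivity
        _ = _ := by ring
    have hpr := fun t (ht : t ∈ Ico 0 T0) =>
      profile θ a h Y0 t ht.1 hθ ha0 hhp hY0p (hPlt t ht)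
    have hBnn : ∀ t ∈ Ico 0 T0, 
        0 ≤ (Y0 * (a * θ * h) * ((1 + t) ^ (θ - 1) * (1 - h * (1 + t) ^ θ) ^ (-a - 2))) := by
      intro t ht
      have h1t : 0 < 1 + t := by linarith [ht.1]
      have hPp : 0 < 1 - h * (1 + t) ^ θ := by linarith [hPlt t ht]
      positivity
    have hYnn : ∀ t ∈ Ico 0 T0, 0 < Y0 * (1 - h * (1 + t) ^ θ) ^ (-a) := by
      intro t ht
      have hPp : 0 < 1 - h * (1 + t) ^ θ := by linarith [hPlt t ht]
      positivity
    rcases hcase with hc | ⟨hc, hc'⟩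
    · refine ode_comparison δ K q ς (ε * A) T0 hK hq _ _ _ U U1 F
        (fun t ht => (hpr t ht).1) (fun t ht => (hpr t ht).2.1) ?_ (fun t ht => (hYnn t ht).le)
        (hUc.mono hIco) (fun t ht => hU t (hIoo ht)) (fun t ht => hU1 t (hIoo ht))
        (fun t ht => hFi t (hIoo ht)) (fun t ht => hF t (hIoo ht)) ?_ ?_
      · intro t ht
        have ht' : t ∈ Ico 0 T0 := ⟨ht.1.le, ht.2⟩
        obtain ⟨-, -, e1, e2⟩ := hpr t ht'
        have e3 := hsubkey t ht'
        have e4 := hBnn t ht'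
        have es : θ - 1 = ς := by linarith
        refine le_trans ?_ (e3.trans (le_of_eq (by rw [es])))
        rw [hL]
        generalize (Y0 * (a * θ * h) * ((1 + t) ^ (θ - 1) *
          (1 - h * (1 + t) ^ θ) ^ (-a - 2))) = B at *
        generalize (Y0 * (a * θ * h) * ((1 + t) ^ (θ - 1) *
          (1 - h * (1 + t) ^ θ) ^ (-a - 1))) = y1 at *
        generalize (Y0 * (a * θ * h) *
          (((θ - 1) * (1 + t) ^ (θ - 1 - 1)) * (1 - h * (1 + t) ^ θ) ^ (-a - 1)
          + (1 + t) ^ (θ - 1) * (-(h * (θ * (1 + t) ^ (θ - 1))) * (-a - 1)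
          * (1 - h * (1 + t) ^ θ) ^ (-a - 1 - 1)))) = y2 at *
        have e5 : y2 ≤ (a + 2) * θ * B := by
          by_cases hy : y2 ≤ 0
          · exact hy.trans (by positivity)
          · push Not at hy
            have := mul_pos ht.1 hy
            linarith
        have e6 := mul_le_mul_of_nonneg_left e1 hδ
        linarith
      · simp only [add_zero, one_rpow, mul_one]
        rw [hU0]; exact hb1
      · simp only [add_zero, one_rpow, mul_one, one_mul]
        have : 0 < Y0 * (1 - h) ^ (-a) := by simpa using hYnn 0 ⟨le_rfl, hT0pos⟩
        linarith
    · have hcmp := ode_comparison δ K q ς (ε * A) T0 hK hq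
        (fun t => (1 + t) * (Y0 * (1 - h * (1 + t) ^ θ) ^ (-a)))
        (fun t => 1 * (Y0 * (1 - h * (1 + t) ^ θ) ^ (-a)) + (1 + t) *
          (Y0 * (a * θ * h) * ((1 + t) ^ (θ - 1) * (1 - h * (1 + t) ^ θ) ^ (-a - 1))))
        (fun t => 1 * (Y0 * (a * θ * h) *
            ((1 + t) ^ (θ - 1) * (1 - h * (1 + t) ^ θ) ^ (-a - 1))) +
          (1 * (Y0 * (a * θ * h) * ((1 + t) ^ (θ - 1) * (1 - h * (1 + t) ^ θ) ^ (-a - 1))) +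
          (1 + t) * (Y0 * (a * θ * h) *
          (((θ - 1) * (1 + t) ^ (θ - 1 - 1)) * (1 - h * (1 + t) ^ θ) ^ (-a - 1)
          + (1 + t) ^ (θ - 1) * (-(h * (θ * (1 + t) ^ (θ - 1))) * (-a - 1)
          * (1 - h * (1 + t) ^ θ) ^ (-a - 1 - 1))))))
        U U1 F
        (fun t ht => ((hasDerivAt_id t).const_add 1).mul (hpr t ht).1)
        (fun t ht => ((hpr t ht).1.const_mul 1).add
          (((hasDerivAt_id t).const_add 1).mul (hpr t ht).2.1))
        ?_ (fun t ht => mul_nonneg (by linarith [ht.1]) (hYnn t ht).le)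
        (hUc.mono hIco) (fun t ht => hU t (hIoo ht)) (fun t ht => hU1 t (hIoo ht))
        (fun t ht => hFi t (hIoo ht)) (fun t ht => hF t (hIoo ht)) ?_ ?_
      · intro t ht
        have e1 := hcmp t ht
        have e2 := hYnn t ht
        nlinarith [ht.1]
      · intro t ht
        have ht' : t ∈ Ico 0 T0 := ⟨ht.1.le, ht.2⟩
        have h1t : 0 < 1 + t := by linarith [ht.1]
        obtain ⟨-, -, e1, e2⟩ := hpr t ht'
        have e3 := hsubkey t ht'
        have e4 := hBnn t ht'
        have es : θ - 1 = ς + q := by linarith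
        refine le_trans ?_ (e3.trans (le_of_eq ?_))
        · rw [hL, hc]
          simp only [zero_mul, add_zero, one_mul]
          linarith
        · rw [mul_rpow h1t.le (hYnn t ht').le, es, rpow_add h1t]
          ring
      · simp only [add_zero, one_rpow, mul_one, one_mul]
        rw [hU0]; exact hb1
      · simp only [add_zero, one_rpow, mul_one, one_mul]
        exact hb2
  -- contradiction from boundedness of `U` on `[0,T0]`
  obtain ⟨M, hM⟩ := (isCompact_Icc (a := (0:ℝ)) (b := T0)).bddAbove_image
    (hUc.mono fun s hs => ⟨hs.1, lt_of_le_of_lt hs.2 hlt⟩)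
  have hbound : ∀ t ∈ Ico 0 T0, Y0 ≤ M * (1 - h * (1 + t) ^ θ) ^ a := by
    intro t ht
    have hPp : 0 < 1 - h * (1 + t) ^ θ := by linarith [hPlt t ht]
    have e1 := hmain t ht
    have e2 : U t ≤ M := hM ⟨t, ⟨ht.1, ht.2.le⟩, rfl⟩
    have e3 : Y0 * (1 - h * (1 + t) ^ θ) ^ (-a) ≤ M := e1.le.trans e2
    rw [rpow_neg hPp.le, ← div_eq_mul_inv, div_le_iff₀ (by positivity)] at e3
    exact e3
  have hcont : ContinuousAt (fun t => M * (1 - h * (1 + t) ^ θ) ^ a) T0 := by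
    refine continuousAt_const.mul (ContinuousAt.rpow_const ?_ (Or.inr ha0.le))
    refine continuousAt_const.sub (continuousAt_const.mul ?_)
    exact ContinuousAt.rpow_const (by fun_prop) (Or.inr hθ.le)
  have hlim := ge_of_tendsto (hcont.tendsto.mono_left (nhdsWithin_le_nhds (s := Iio T0)))
    (b := Y0) (by
      filter_upwards [Ioo_mem_nhdsLT hT0pos] with t ht
      exact hbound t ⟨ht.1.le, ht.2⟩)
  simp only [hT0P, sub_self, zero_rpow ha0.ne', mul_zero] at hlim
  linarith

lemma holder_ball {E : Type*} [MeasurableSpace E] (μ : Measure E) (B : Set E)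
    (hB0 : μ B ≠ 0) (hB1 : μ B ≠ ⊤) (f : E → ℝ) (p : ℝ) (hp : 1 < p)
    (hf : Integrable f μ) (hfp : Integrable (fun x => |f x| ^ p) μ)
    (hs : ∀ x, f x ≠ 0 → x ∈ B) :
    |∫ x, f x ∂μ| ^ p ≤ (μ.real B) ^ (p - 1) * ∫ x, |f x| ^ p ∂μ := by
  have hBp : 0 < μ.real B := ENNReal.toReal_pos hB0 hB1
  have h1 := (convexOn_rpow hp.le).map_set_average_le (μ := μ) (t := B)
    (f := fun x => |f x|) (continuousOn_id.rpow_const fun x _ => Or.inr (by linarith))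
    isClosed_Ici hB0 hB1 (Filter.Eventually.of_forall fun x => abs_nonneg (f x))
    hf.abs.integrableOn hfp.integrableOn
  rw [setAverage_eq, setAverage_eq] at h1
  have e1 : ∫ x in B, |f x| ∂μ = ∫ x, |f x| ∂μ :=
    setIntegral_eq_integral_of_forall_compl_eq_zero fun x hx => by
      by_contra h
      exact hx (hs x fun h' => h (by simp [h']))
  have e2 : ∫ x in B, |f x| ^ p ∂μ = ∫ x, |f x| ^ p ∂μ :=
    setIntegral_eq_integral_of_forall_compl_eq_zero fun x hx => by
      by_contra h
      refine hx (hs x fun h' => h ?_)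
      rw [h', abs_zero, zero_rpow (by linarith)]
  rw [e1, e2, smul_eq_mul, smul_eq_mul, mul_rpow (by positivity)
    (integral_nonneg fun x => abs_nonneg _)] at h1
  have h2 : |∫ x, f x ∂μ| ^ p ≤ (∫ x, |f x| ∂μ) ^ p :=
    rpow_le_rpow (abs_nonneg _) (abs_integral_le_integral_abs) (by linarith)
  refine h2.trans ?_
  have h3 := mul_le_mul_of_nonneg_left h1 (rpow_nonneg hBp.le p)
  rw [← mul_assoc, ← mul_rpow hBp.le (by positivity), mul_inv_cancel₀ hBp.ne', one_rpow,
    one_mul] at h3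
  refine h3.trans (le_of_eq ?_)
  rw [rpow_sub_one hBp.ne']
  field_simp

lemma lapl_eq_zero {n : ℕ} (f : Eucl n → ℝ) (x : Eucl n) (k : ℝ)
    (h : f =ᶠ[nhds x] fun _ => k) : lapl f x = 0 := by
  unfold lapl
  apply Finset.sum_eq_zero
  intro i _
  have h2 : (fun y => fderiv ℝ f y (EuclideanSpace.single i 1)) =ᶠ[nhds x] fun _ => (0:ℝ) := by
    filter_upwards [h.fderiv (𝕜 := ℝ)] with y hy
    rw [hy]
    simp
  rw [h2.fderiv_eq]
  simp

lemma test_identity {n : ℕ} {c H b m2 p β : ℝ} {Γ : ℝ → ℝ} {ε : ℝ} {v0 v1 : Eucl n → ℝ}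
    {R T : ℝ} {v vt : ℝ → Eucl n → ℝ} (hc : 0 < c) (hH : 0 < H) (hR : 0 < R) (hp : 1 < p)
    (hv0s : ∀ x, v0 x ≠ 0 → ‖x‖ ≤ R) (hv1s : ∀ x, v1 x ≠ 0 → ‖x‖ ≤ R)
    (hsol : IsWeakSolADS n c H b m2 p β Γ ε v0 v1 R T v vt) (t1 : ℝ) (h0 : 0 < t1) (h1 : t1 < T) :
    ∃ g : Eucl n → ℝ, Continuous g ∧ HasCompactSupport g ∧
      (∀ s ∈ Ioc 0 t1, ∀ x, v s x * g x = v s x) ∧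
      ∀ ψ : ℝ → ℝ, ContDiff ℝ (⊤ : ℕ∞) ψ → ∀ t ∈ Ioc 0 t1,
        (∫ x, vt t x * g x) * ψ t - (∫ x, v t x * g x) * deriv ψ t
          + b * ((∫ x, v t x * g x) * ψ t)
          + (∫ s in (0:ℝ)..t, (∫ x, v s x * g x) *
              (deriv (deriv ψ) s - b * deriv ψ s + m2 * ψ s))
        = ε * ((∫ x, v1 x) * ψ 0) + ε * ((∫ x, v0 x) * (b * ψ 0 - deriv ψ 0))
          + ∫ s in (0:ℝ)..t, Γ s * (∫ y, |v s y| ^ p) ^ β * (∫ x, |v s x| ^ p) * ψ s := by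
  have hexp : 1 ≤ exp (H * t1) := one_le_exp (by positivity)
  have hcH : 0 < c / H := by positivity
  obtain ⟨R1, hR1⟩ : ∃ R1, R1 = R + (c / H) * (exp (H * t1) - 1) := ⟨_, rfl⟩
  have hRR1 : R ≤ R1 := by rw [hR1]; nlinarith
  let g : ContDiffBump (0 : Eucl n) := ⟨R1 + 1, R1 + 2, by linarith, by linarith⟩
  let χ : ContDiffBump (0 : ℝ) := ⟨(2 * t1 + T) / 3, (t1 + 2 * T) / 3, by linarith, by linarith⟩
  have hg1 : ∀ x : Eucl n, ‖x‖ ≤ R1 → g =ᶠ[nhds x] fun _ => 1 := by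
    intro x hx
    exact g.eventuallyEq_one_of_mem_ball (by
      rw [mem_ball_zero_iff]; change ‖x‖ < R1 + 1; linarith)
  have hχ1 : ∀ s ∈ Icc 0 t1, χ =ᶠ[nhds s] fun _ => 1 := by
    intro s hs
    exact χ.eventuallyEq_one_of_mem_ball (by
      rw [mem_ball_zero_iff, Real.norm_eq_abs, abs_of_nonneg hs.1]
      change s < (2 * t1 + T) / 3; linarith [hs.2])
  have hsupp : ∀ s ∈ Ioc 0 t1, ∀ x, v s x ≠ 0 → ‖x‖ ≤ R1 := by
    intro s hs x hx
    refine (hsol.supp s ⟨hs.1, lt_of_le_of_lt hs.2 h1⟩ x hx).trans ?_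
    rw [hR1]
    have := hs.2
    gcongr
  have hvg : ∀ s ∈ Ioc 0 t1, ∀ x, v s x * g x = v s x := by
    intro s hs x
    by_cases hx : v s x = 0
    · simp [hx]
    · rw [(hg1 x (hsupp s hs x hx)).eq_of_nhds, mul_one]
  have hvpg : ∀ s ∈ Ioc 0 t1, ∀ x, |v s x| ^ p * g x = |v s x| ^ p := by
    intro s hs x
    by_cases hx : v s x = 0
    · rw [hx, abs_zero, zero_rpow (by linarith), zero_mul]
    · rw [(hg1 x (hsupp s hs x hx)).eq_of_nhds, mul_one]
  have hv0g : ∀ x, v0 x * g x = v0 x := by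
    intro x
    by_cases hx : v0 x = 0
    · simp [hx]
    · rw [(hg1 x ((hv0s x hx).trans hRR1)).eq_of_nhds, mul_one]
  have hv1g : ∀ x, v1 x * g x = v1 x := by
    intro x
    by_cases hx : v1 x = 0
    · simp [hx]
    · rw [(hg1 x ((hv1s x hx).trans hRR1)).eq_of_nhds, mul_one]
  refine ⟨g, g.continuous, g.hasCompactSupport, hvg, ?_⟩
  intro ψ hψ t ht
  have htest : IsTestFn T (fun s (x : Eucl n) => χ s * ψ s * g x) := by
    refine ⟨?_, ?_, (t1 + 2 * T) / 3, by linarith, ?_⟩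
    · exact ((χ.contDiff.comp contDiff_fst).mul (hψ.comp contDiff_fst)).mul
        (g.contDiff.comp contDiff_snd)
    · refine HasCompactSupport.intro
        ((isCompact_closedBall (0:ℝ) χ.rOut).prod (isCompact_closedBall (0 : Eucl n) g.rOut)) ?_
      rintro ⟨s, x⟩ hsx
      rw [Set.mem_prod, not_and_or] at hsx
      rcases hsx with hs | hx
      · have : χ s = 0 := χ.zero_of_le_dist (by
          rw [Metric.mem_closedBall, not_le] at hs; exact hs.le)
        simp [this]
      · have : g x = 0 := g.zero_of_le_dist (by
          rw [Metric.mem_closedBall, not_le] at hx; exact hx.le)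
        simp [this]
    · intro s hs x
      have : χ s = 0 := χ.zero_of_le_dist (by
        rw [dist_zero_right, Real.norm_eq_abs]
        exact (show χ.rOut ≤ s from hs).trans (le_abs_self s))
      simp [this]
  have hφ : ∀ s ∈ Icc 0 t1, ∀ x, χ s * ψ s * g x = ψ s * g x := by
    intro s hs x
    rw [(hχ1 s hs).eq_of_nhds, one_mul]
  have hev : ∀ s ∈ Icc 0 t1, ∀ x, (fun r => χ r * ψ r * g x) =ᶠ[nhds s] fun r => ψ r * g x := by
    intro s hs x
    filter_upwards [hχ1 s hs] with r hr
    rw [hr, one_mul]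
  have hdψ : (fun x => deriv (fun r => ψ r * g x)) = fun x r => deriv ψ r * g x := by
    ext x r
    exact deriv_mul_const (hψ.differentiable (by simp) r) _
  have hψ' : ContDiff ℝ (⊤ : ℕ∞) (deriv ψ) := by
    have := (contDiff_infty_iff_deriv (f := ψ)).1 hψ
    exact this.2
  have hd1 : ∀ s ∈ Icc 0 t1, ∀ x, deriv (fun r => χ r * ψ r * g x) s = deriv ψ s * g x := by
    intro s hs x
    rw [(hev s hs x).deriv_eq, congrFun hdψ x]
  have hd2 : ∀ s ∈ Icc 0 t1, ∀ x,
      deriv (deriv (fun r => χ r * ψ r * g x)) s = deriv (deriv ψ) s * g x := by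
    intro s hs x
    rw [(hev s hs x).deriv.deriv_eq, congrFun hdψ x]
    exact deriv_mul_const (hψ'.differentiable (by simp) s) _
  have hid := hsol.identity t ⟨ht.1, lt_of_le_of_lt ht.2 h1⟩ _ htest
  have ht' : t ∈ Icc 0 t1 := ⟨ht.1.le, ht.2⟩
  have h0' : (0:ℝ) ∈ Icc 0 t1 := ⟨le_rfl, h0.le⟩
  simp only [hφ t ht', hφ 0 h0', hd1 t ht', hd1 0 h0'] at hid
  have i1 : (∫ s in (0:ℝ)..t, ∫ x, v s x *
            (deriv (deriv (fun r => χ r * ψ r * g x)) s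
              - c ^ 2 * exp (2 * H * s) * lapl (fun y => χ s * ψ s * g y) x
              - b * deriv (fun r => χ r * ψ r * g x) s + m2 * (χ s * ψ s * g x)))
      = (∫ s in (0:ℝ)..t, (∫ x, v s x * g x) *
              (deriv (deriv ψ) s - b * deriv ψ s + m2 * ψ s)) := by
    apply intervalIntegral.integral_congr_ae
    refine Filter.Eventually.of_forall fun s hs => ?_
    rw [uIoc_of_le ht.1.le] at hs
    have hs1 : s ∈ Ioc 0 t1 := ⟨hs.1, hs.2.trans ht.2⟩
    have hs2 : s ∈ Icc 0 t1 := ⟨hs.1.le, hs.2.trans ht.2⟩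
    rw [← integral_mul_const]
    congr 1
    ext x
    by_cases hx : v s x = 0
    · simp [hx]
    · rw [hd2 s hs2, hd1 s hs2, hφ s hs2, lapl_eq_zero _ x (χ s * ψ s * 1)]
      · ring
      · filter_upwards [hg1 x (hsupp s hs1 x hx)] with y hy
        rw [hy]
  have i2 : (∫ s in (0:ℝ)..t, Γ s * (∫ y, |v s y| ^ p) ^ β *
        (∫ x, |v s x| ^ p * (χ s * ψ s * g x)))
      = ∫ s in (0:ℝ)..t, Γ s * (∫ y, |v s y| ^ p) ^ β * (∫ x, |v s x| ^ p) * ψ s := by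
    apply intervalIntegral.integral_congr_ae
    refine Filter.Eventually.of_forall fun s hs => ?_
    rw [uIoc_of_le ht.1.le] at hs
    have hs1 : s ∈ Ioc 0 t1 := ⟨hs.1, hs.2.trans ht.2⟩
    have hs2 : s ∈ Icc 0 t1 := ⟨hs.1.le, hs.2.trans ht.2⟩
    have : ∀ x, |v s x| ^ p * (χ s * ψ s * g x) = |v s x| ^ p * ψ s := by
      intro x
      rw [hφ s hs2]
      calc _ = (|v s x| ^ p * g x) * ψ s := by ring
        _ = _ := by rw [hvpg s hs1]
    simp only [this]
    rw [integral_mul_const]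
    ring
  rw [i1, i2] at hid
  have j1 : ∀ (w : Eucl n → ℝ) (k : ℝ), ∫ x, w x * (k * g x) = (∫ x, w x * g x) * k := by
    intro w k
    rw [← integral_mul_const]
    congr 1
    ext x
    ring
  have j2 : ∫ x, v0 x * (b * (ψ 0 * g x) - deriv ψ 0 * g x)
      = (∫ x, v0 x) * (b * ψ 0 - deriv ψ 0) := by
    rw [← integral_mul_const]
    congr 1
    ext x
    calc _ = (v0 x * g x) * (b * ψ 0 - deriv ψ 0) := by ring
      _ = _ := by rw [hv0g]
  rw [j1, j1, j1, j1, j2] at hid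
  simp only [hv1g] at hid
  exact hid

lemma sol_reduce {n : ℕ} {c H b m2 p β ς μ : ℝ} {Γ : ℝ → ℝ} {ε : ℝ} {v0 v1 : Eucl n → ℝ}
    {R T : ℝ} {v vt : ℝ → Eucl n → ℝ} (r1 r2 Bv : ℝ)
    (hc : 0 < c) (hH : 0 < H) (hR : 0 < R) (hp : 1 < p) (hβ : 0 ≤ β) (hμ : 0 < μ)
    (hr : r1 + r2 = b) (hrr : r1 * r2 = m2)
    (hBv : Bv = (R + c / H) ^ n * (volume : Measure (Eucl n)).real (Metric.ball 0 1))
    (hv0s : ∀ x, v0 x ≠ 0 → ‖x‖ ≤ R) (hv1s : ∀ x, v1 x ≠ 0 → ‖x‖ ≤ R)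
    (hΓ : ∀ t, Γ t = μ * exp ((r1 * ((β + 1) * p - 1) + n * H * (β + 1) * (p - 1)) * t)
      * (1 + t) ^ ς)
    (hsol : IsWeakSolADS n c H b m2 p β Γ ε v0 v1 R T v vt) (t1 : ℝ) (h0 : 0 < t1) (h1 : t1 < T) :
    ∃ U U1 F : ℝ → ℝ,
      ContinuousOn U (Ico 0 t1) ∧ (∀ t ∈ Ioo 0 t1, HasDerivAt U (U1 t) t) ∧
      (∀ t ∈ Ioo 0 t1, exp ((r2 - r1) * t) * U1 t
        = ε * ((∫ x, v1 x) + r1 * ∫ x, v0 x) + ∫ s in (0:ℝ)..t, F s) ∧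
      (∀ t ∈ Ioo 0 t1, IntervalIntegrable F volume 0 t) ∧
      (∀ s ∈ Ioo 0 t1, (μ * (Bv ^ ((p - 1) * (β + 1)))⁻¹) * exp ((r2 - r1) * s) * (1 + s) ^ ς
        * |U s| ^ ((β + 1) * p) ≤ F s) ∧
      U 0 = ε * ∫ x, v0 x := by
  obtain ⟨g, hgc, hgs, hvg, hid⟩ := test_identity hc hH hR hp hv0s hv1s hsol t1 h0 h1
  obtain ⟨hVd, hWc⟩ := hsol.c1 g hgc hgs
  obtain ⟨V, hV⟩ : ∃ V : ℝ → ℝ, V = fun s => ∫ x, v s x * g x := ⟨_, rfl⟩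
  obtain ⟨W, hW⟩ : ∃ W : ℝ → ℝ, W = fun s => ∫ x, vt s x * g x := ⟨_, rfl⟩
  obtain ⟨f, hf⟩ : ∃ f : ℝ → ℝ, f = fun s => Γ s * (∫ y, |v s y| ^ p) ^ β * ∫ x, |v s x| ^ p :=
    ⟨_, rfl⟩
  have hVd : ∀ t ∈ Ico 0 T, HasDerivWithinAt V (W t) (Ico 0 T) t := by rw [hV, hW]; exact hVd
  have hWc : ContinuousOn W (Ico 0 T) := by rw [hW]; exact hWc
  have hVc : ContinuousOn V (Ico 0 T) := fun t ht => (hVd t ht).continuousWithinAt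
  have hfi : ∀ t ∈ Ico 0 T, IntervalIntegrable f volume 0 t := by
    rw [hf]; exact hsol.nonlin_L1loc
  have hid' : ∀ ψ : ℝ → ℝ, ContDiff ℝ (⊤ : ℕ∞) ψ → ∀ t ∈ Ioc 0 t1,
        W t * ψ t - V t * deriv ψ t + b * (V t * ψ t)
          + (∫ s in (0:ℝ)..t, V s * (deriv (deriv ψ) s - b * deriv ψ s + m2 * ψ s))
        = ε * ((∫ x, v1 x) * ψ 0) + ε * ((∫ x, v0 x) * (b * ψ 0 - deriv ψ 0))
          + ∫ s in (0:ℝ)..t, f s * ψ s := by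
    rw [hV, hW, hf]; exact hid
  have hVeq : ∀ s ∈ Ioc 0 t1, V s = ∫ x, v s x := by
    intro s hs
    rw [hV]
    simp only [hvg s hs]
  clear hid
  have hT : 0 < T := h0.trans h1
  -- the initial value
  have hV0 : V 0 = ε * ∫ x, v0 x := by
    have hnb : (nhdsWithin (0:ℝ) (Ioc 0 t1)).NeBot := by
      rw [nhdsWithin_Ioc_eq_nhdsGT h0]; infer_instance
    have hsubT : Ioc 0 t1 ⊆ Ico 0 T := fun s hs => ⟨hs.1.le, lt_of_le_of_lt hs.2 h1⟩
    have hsubI : Ioc 0 t1 ⊆ uIcc 0 t1 := by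
      rw [uIcc_of_le h0.le]; exact Ioc_subset_Icc_self
    have c0 : Filter.Tendsto (fun t : ℝ => t) (nhdsWithin 0 (Ioc 0 t1)) (nhds 0) :=
      nhdsWithin_le_nhds
    have cV : Filter.Tendsto V (nhdsWithin 0 (Ioc 0 t1)) (nhds (V 0)) :=
      (hVc 0 ⟨le_rfl, hT⟩).mono hsubT
    have cW : Filter.Tendsto W (nhdsWithin 0 (Ioc 0 t1)) (nhds (W 0)) :=
      (hWc 0 ⟨le_rfl, hT⟩).mono hsubT
    have prim : ∀ k : ℝ → ℝ, IntervalIntegrable k volume 0 t1 →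
        Filter.Tendsto (fun t => ∫ s in (0:ℝ)..t, k s) (nhdsWithin 0 (Ioc 0 t1)) (nhds 0) := by
      intro k hk
      have := (intervalIntegral.continuousOn_primitive_interval' hk left_mem_uIcc
        0 left_mem_uIcc).mono hsubI
      simpa [ContinuousWithinAt] using this
    have p1 := prim (fun s => V s * (0 - b * 1 + m2 * s)) (by
      apply ContinuousOn.intervalIntegrable
      rw [uIcc_of_le h0.le]
      refine (hVc.mono fun s hs => ⟨hs.1, lt_of_le_of_lt hs.2 h1⟩).mul (by fun_prop))
    have p2 := prim (fun s => f s * s) ((hfi t1 ⟨h0.le, h1⟩).mul_continuousOn (by fun_prop))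
    have lim1 := (((cW.mul c0).sub cV).add ((cV.mul c0).const_mul b)).add p1
    have lim2 := p2.const_add (-(ε * ∫ x, v0 x))
    have hEq : (fun t => W t * t - V t + b * (V t * t) +
        ∫ s in (0:ℝ)..t, V s * (0 - b * 1 + m2 * s)) =ᶠ[nhdsWithin 0 (Ioc 0 t1)]
        fun t => -(ε * ∫ x, v0 x) + ∫ s in (0:ℝ)..t, f s * s := by
      filter_upwards [self_mem_nhdsWithin] with t ht
      have := hid' (fun s => s) contDiff_id t ht
      have d1 : deriv (fun s : ℝ => s) = fun _ => 1 := by ext; simp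
      have d2 : deriv (fun _ : ℝ => (1:ℝ)) = fun _ => 0 := by ext; simp
      simp only [d1, d2] at this
      linarith
    have := tendsto_nhds_unique (lim1.congr' hEq) lim2
    simp only [mul_zero, add_zero, zero_sub] at this
    linarith
  have hE : ∀ r s : ℝ, HasDerivAt (fun s => exp (r * s)) (exp (r * s) * r) s := by
    intro r s
    simpa using ((hasDerivAt_id s).const_mul r).exp
  have hVd' : ∀ t ∈ Ioo 0 t1, HasDerivAt V (W t) t := fun t ht =>
    (hVd t ⟨ht.1.le, ht.2.trans h1⟩).hasDerivAt (Ico_mem_nhds ht.1 (ht.2.trans h1))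
  refine ⟨fun t => exp (r1 * t) * V t, fun t => exp (r1 * t) * r1 * V t + exp (r1 * t) * W t,
    fun s => f s * exp (r2 * s), ?_, ?_, ?_, ?_, ?_, ?_⟩
  · refine ContinuousOn.mul (by fun_prop) (hVc.mono (Ico_subset_Ico_right h1.le))
  · intro t ht
    exact (hE r1 t).mul (hVd' t ht)
  · intro t ht
    have := hid' (fun s => exp (r2 * s)) (by fun_prop) t ⟨ht.1, ht.2.le⟩
    have d1 : deriv (fun s : ℝ => exp (r2 * s)) = fun s => exp (r2 * s) * r2 := by
      ext s; exact (hE r2 s).deriv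
    have d2 : deriv (fun s : ℝ => exp (r2 * s) * r2) = fun s => exp (r2 * s) * r2 * r2 := by
      ext s; exact ((hE r2 s).mul_const r2).deriv
    simp only [d1, d2] at this
    have z : ∀ s, V s * (exp (r2 * s) * r2 * r2 - b * (exp (r2 * s) * r2) + m2 * exp (r2 * s))
        = 0 := by
      intro s
      rw [← hr, ← hrr]; ring
    simp only [z, intervalIntegral.integral_zero, mul_zero, exp_zero, one_mul, mul_one,
      add_zero] at this
    have e : exp (r2 * t) = exp ((r2 - r1) * t) * exp (r1 * t) := by
      rw [← exp_add]; ring_nf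
    have hb : b - r2 = r1 := by linarith
    rw [hb] at this
    calc _ = (exp ((r2 - r1) * t) * exp (r1 * t)) * (W t + (b - r2) * V t) := by rw [hb]; ring
      _ = W t * exp (r2 * t) - V t * (exp (r2 * t) * r2) + b * (V t * exp (r2 * t)) := by
        rw [← e]; ring
      _ = _ := by rw [this]; ring
  · intro t ht
    exact (hfi t ⟨ht.1.le, ht.2.trans h1⟩).mul_continuousOn (by fun_prop)
  · intro s hs
    have hsT : s ∈ Ioo 0 T := ⟨hs.1, hs.2.trans h1⟩
    have hsT' : s ∈ Ico 0 T := ⟨hs.1.le, hs.2.trans h1⟩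
    obtain ⟨N, hN⟩ : ∃ N, N = ∫ y, |v s y| ^ p := ⟨_, rfl⟩
    have hN0 : 0 ≤ N := by rw [hN]; exact integral_nonneg fun x => rpow_nonneg (abs_nonneg _) _
    obtain ⟨ρ, hρ⟩ : ∃ ρ, ρ = R + (c / H) * (exp (H * s) - 1) := ⟨_, rfl⟩
    have hcH : 0 < c / H := by positivity
    have hes : 1 ≤ exp (H * s) := one_le_exp (by have := hs.1; positivity)
    have hρ0 : 0 < ρ := by rw [hρ]; nlinarith
    have hρ1 : ρ ≤ (R + c / H) * exp (H * s) := by rw [hρ]; nlinarith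
    have hvol : (volume : Measure (Eucl n)).real (Metric.closedBall 0 ρ)
        ≤ Bv * exp (n * H * s) := by
      rw [Measure.real, Measure.addHaar_closedBall _ _ hρ0.le, ENNReal.toReal_mul,
        ENNReal.toReal_ofReal (by positivity), finrank_euclideanSpace_fin, ← Measure.real, hBv]
      calc ρ ^ n * (volume : Measure (Eucl n)).real (Metric.ball 0 1)
          ≤ ((R + c / H) * exp (H * s)) ^ n
            * (volume : Measure (Eucl n)).real (Metric.ball 0 1) := by gcongr
        _ = _ := by
          rw [mul_pow, ← exp_nat_mul]; ring_nf
    have hBv0 : 0 < Bv := by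
      rw [hBv]
      have : 0 < (volume : Measure (Eucl n)).real (Metric.ball 0 1) :=
        ENNReal.toReal_pos (Metric.measure_ball_pos _ _ one_pos).ne' measure_ball_lt_top.ne
      positivity
    have hold := holder_ball (volume : Measure (Eucl n)) (Metric.closedBall 0 ρ)
      (Metric.measure_closedBall_pos _ _ hρ0).ne' measure_closedBall_lt_top.ne (v s) p hp
      (hsol.integ_v s hsT') (hsol.integ_pow s hsT') (fun x hx => by
        rw [mem_closedBall_zero_iff, hρ]; exact hsol.supp s hsT x hx)
    rw [← hN, ← hVeq s ⟨hs.1, hs.2.le⟩] at hold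
    have hold2 : |V s| ^ p ≤ (Bv * exp (n * H * s)) ^ (p - 1) * N := by
      refine hold.trans ?_
      gcongr
    have hold3 := rpow_le_rpow (by positivity) hold2 (by linarith : 0 ≤ β + 1)
    rw [← rpow_mul (abs_nonneg _), mul_rpow (by positivity) hN0, ← rpow_mul (by positivity),
      mul_rpow hBv0.le (exp_pos _).le, ← exp_mul] at hold3
    have hNN : N ^ β * N = N ^ (β + 1) := by
      rw [rpow_add_of_nonneg hN0 hβ zero_le_one, rpow_one]
    have hfs : f s = Γ s * N ^ (β + 1) := by
      rw [hf, ← hNN]; simp only [← hN]; ring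
    have hU : |exp (r1 * s) * V s| ^ ((β + 1) * p) =
        exp (r1 * s * ((β + 1) * p)) * |V s| ^ (p * (β + 1)) := by
      rw [abs_mul, abs_of_pos (exp_pos _), mul_rpow (exp_pos _).le (abs_nonneg _), ← exp_mul,
        mul_comm p]
    have hs1 : 0 < 1 + s := by linarith [hs.1]
    simp only
    rw [hU, hfs, hΓ]
    obtain ⟨X, hX⟩ : ∃ X, X = Bv ^ ((p - 1) * (β + 1)) := ⟨_, rfl⟩
    have hX0 : 0 < X := by rw [hX]; positivity
    rw [← hX] at hold3 ⊢
    calc _ ≤ μ * X⁻¹ * exp ((r2 - r1) * s) * (1 + s) ^ ς * (exp (r1 * s * ((β + 1) * p)) *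
          (X * exp (n * H * s * ((p - 1) * (β + 1))) * N ^ (β + 1))) := by gcongr
      _ = μ * (exp ((r2 - r1) * s) * exp (r1 * s * ((β + 1) * p)) *
          exp (n * H * s * ((p - 1) * (β + 1)))) * (1 + s) ^ ς * N ^ (β + 1) := by
          field_simp
      _ = μ * (exp ((r1 * ((β + 1) * p - 1) + n * H * (β + 1) * (p - 1)) * s) * exp (r2 * s))
          * (1 + s) ^ ς * N ^ (β + 1) := by
          rw [← exp_add, ← exp_add, ← exp_add]; ring_nf
      _ = _ := by ring
  · simp [hV0]

/-- **Theorem 5 (anti-de Sitter, polynomial growth, low-dimensional case).**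
Blow-up and lifespan estimates for the semilinear wave equation in anti-de Sitter spacetime
when `n/2 − √(b²−4m²)/(2H) ≤ 1/p` and `Γ(t) = μ e^{ϱ_crit t}(1+t)^ς` with
`ϱ_crit = ½(b−√(b²−4m²))((β+1)p−1) + nH(β+1)(p−1)` and `ς > κ_crit(b,m²,β,p)`,
where `κ_crit = −1` if `b² > 4m²` and `κ_crit = −1−(β+1)p` if `b² = 4m²`.
The lifespan satisfies `T(ε) ≤ C ε^{−((β+1)p−1)/(ς+1)}` if `b² > 4m²` and
`T(ε) ≤ C ε^{−((ς+2)/((β+1)p−1)+1)⁻¹}` if `b² = 4m²`. -/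
theorem antiDeSitter_blowup_polynomial_growth_low_dim
    (n : ℕ) (hn : 1 ≤ n) (c H b m2 β p ς μ R : ℝ)
    (hc : 0 < c) (hH : 0 < H) (hb : 0 ≤ b) (hm2 : 0 ≤ m2) (hdom : 4 * m2 ≤ b ^ 2)
    (hβ : 0 ≤ β) (hp : 1 < p)
    (hdim : (n : ℝ) / 2 - Real.sqrt (b ^ 2 - 4 * m2) / (2 * H) ≤ 1 / p)
    (hς₁ : 4 * m2 < b ^ 2 → -1 < ς)
    (hς₂ : b ^ 2 = 4 * m2 → -1 - (β + 1) * p < ς)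
    (hμ : 0 < μ) (hR : 0 < R)
    (v0 v1 : Eucl n → ℝ)
    (hv0 : ∀ x, 0 ≤ v0 x) (hv1 : ∀ x, 0 ≤ v1 x)
    (hv0i : Integrable v0) (hv1i : Integrable v1)
    (hv0s : ∀ x, v0 x ≠ 0 → ‖x‖ ≤ R) (hv1s : ∀ x, v1 x ≠ 0 → ‖x‖ ≤ R)
    (hv0nt : 0 < ∫ x, v0 x) (hv1nt : 0 < ∫ x, v1 x) :
    ∃ ε₀ > 0, ∃ C > 0, ∀ ε : ℝ, 0 < ε → ε ≤ ε₀ →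
      -- the weak solution blows up in finite time: there is no global-in-time weak solution
      (¬ ∃ v vt : ℝ → Eucl n → ℝ, ∀ T : ℝ, 0 < T →
          IsWeakSolADS n c H b m2 p β
            (fun t => μ * exp (((1/2) * (b - Real.sqrt (b ^ 2 - 4 * m2)) * ((β + 1) * p - 1)
              + n * H * (β + 1) * (p - 1)) * t) * (1 + t) ^ ς) ε v0 v1 R T v vt) ∧
      -- upper bound estimates for the lifespan
      (∀ T : ℝ, 0 < T → ∀ v vt : ℝ → Eucl n → ℝ,
        IsWeakSolADS n c H b m2 p β
          (fun t => μ * exp (((1/2) * (b - Real.sqrt (b ^ 2 - 4 * m2)) * ((β + 1) * p - 1)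
            + n * H * (β + 1) * (p - 1)) * t) * (1 + t) ^ ς) ε v0 v1 R T v vt →
        (4 * m2 < b ^ 2 →
          T ≤ C * ε ^ (-(((β + 1) * p - 1) / (ς + 1)))) ∧
        (b ^ 2 = 4 * m2 →
          T ≤ C * ε ^ (-((ς + 2) / ((β + 1) * p - 1) + 1)⁻¹))) := by
  obtain ⟨δ, hδ⟩ : ∃ δ, δ = Real.sqrt (b ^ 2 - 4 * m2) := ⟨_, rfl⟩
  have hδ0 : 0 ≤ δ := by rw [hδ]; exact Real.sqrt_nonneg _
  have hδ2 : δ ^ 2 = b ^ 2 - 4 * m2 := by rw [hδ]; exact Real.sq_sqrt (by linarith)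
  have hδb : δ ≤ b := by nlinarith
  rw [← hδ]
  obtain ⟨r1, hr1⟩ : ∃ r1, r1 = (1/2) * (b - δ) := ⟨_, rfl⟩
  obtain ⟨r2, hr2⟩ : ∃ r2, r2 = (1/2) * (b + δ) := ⟨_, rfl⟩
  have hr10 : 0 ≤ r1 := by rw [hr1]; linarith
  have hrd : r2 - r1 = δ := by rw [hr1, hr2]; ring
  rw [← hr1]
  obtain ⟨q, hq⟩ : ∃ q, q = (β + 1) * p := ⟨_, rfl⟩
  have hq1 : 1 < q := by rw [hq]; nlinarith
  obtain ⟨Bv, hBv⟩ : ∃ Bv, Bv = (R + c / H) ^ n *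
    (volume : Measure (Eucl n)).real (Metric.ball 0 1) := ⟨_, rfl⟩
  have hBv0 : 0 < Bv := by
    rw [hBv]
    have : 0 < (volume : Measure (Eucl n)).real (Metric.ball 0 1) :=
      ENNReal.toReal_pos (Metric.measure_ball_pos _ _ one_pos).ne' measure_ball_lt_top.ne
    positivity
  obtain ⟨θ, hθ0, hcase, hθ1, hθ2⟩ : ∃ θ > 0, (θ = ς + 1 ∨ (δ = 0 ∧ θ = ς + 1 + q)) ∧
      (4 * m2 < b ^ 2 → θ = ς + 1) ∧ (b ^ 2 = 4 * m2 → θ = ς + 1 + q) := by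
    rcases hdom.lt_or_eq with hlt | heq
    · exact ⟨ς + 1, by linarith [hς₁ hlt], Or.inl rfl, fun _ => rfl, fun h => by linarith⟩
    · refine ⟨ς + 1 + q, by rw [hq]; linarith [hς₂ heq.symm], Or.inr ⟨?_, rfl⟩,
        fun h => by linarith, fun _ => rfl⟩
      have : δ ^ 2 = 0 := by rw [hδ2]; linarith
      exact pow_eq_zero_iff (two_ne_zero) |>.1 this
  obtain ⟨C, hC0, hC⟩ := ode_lifespan δ (μ * (Bv ^ ((p - 1) * (β + 1)))⁻¹) q ς θ
    ((∫ x, v1 x) + r1 * ∫ x, v0 x) (∫ x, v0 x) hδ0 (by positivity) hq1 hθ0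
    (by positivity) hv0nt hcase
  have key : ∀ ε : ℝ, 0 < ε → ε ≤ 1 → ∀ T : ℝ, 0 < T → ∀ v vt : ℝ → Eucl n → ℝ,
      IsWeakSolADS n c H b m2 p β
          (fun t => μ * exp ((r1 * ((β + 1) * p - 1)
            + n * H * (β + 1) * (p - 1)) * t) * (1 + t) ^ ς) ε v0 v1 R T v vt →
      T ≤ C * ε ^ (-((q - 1) / θ)) := by
    intro ε hε hε1 T hT v vt hsol
    refine le_of_forall_lt_imp_le_of_dense fun t1 ht1 => ?_
    by_cases h0 : 0 < t1
    · obtain ⟨U, U1, F, a1, a2, a3, a4, a5, a6⟩ := sol_reduce (μ := μ) (ς := ς) r1 r2 Bv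
        hc hH hR hp hβ hμ (by rw [hr1, hr2]; ring) (by rw [hr1, hr2]; nlinarith) hBv hv0s hv1s
        (fun t => rfl) hsol t1 h0 ht1
      rw [hrd] at a3 a5
      rw [← hq] at a5
      exact hC ε hε hε1 t1 U U1 F a1 a2 a3 a4 a5 a6
    · push Not at h0
      exact h0.trans (by positivity)
  refine ⟨1, one_pos, C, hC0, fun ε hε hε1 => ⟨?_, ?_⟩⟩
  · rintro ⟨v, vt, h⟩
    have hpos : 0 < C * ε ^ (-((q - 1) / θ)) := by positivity
    have := key ε hε hε1 (C * ε ^ (-((q - 1) / θ)) + 1) (by linarith) v vt (h _ (by linarith))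
    linarith
  · intro T hT v vt hsol
    have hk := key ε hε hε1 T hT v vt hsol
    rw [← hq]
    refine ⟨fun h => ?_, fun h => ?_⟩
    · rw [← hθ1 h]; exact hk
    · have : ((ς + 2) / (q - 1) + 1)⁻¹ = (q - 1) / θ := by
        have h1 : q - 1 ≠ 0 := by linarith
        rw [hθ2 h, show (ς + 2) / (q - 1) + 1 = (ς + 1 + q) / (q - 1) by field_simp; ring, inv_div]
      rw [this]; exact hk
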